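/- The abelian complexity function ρ of the ordinary paperfolding word satisfies ρ(2^n) = 3 for all n ≥ 1. -/

import Mathlib

/-- The ordinary paperfolding word over `{0,1}`, indexed from 1:
writing `n = n' * 2^k` with `n'` odd, `pf n = 0` if `n' ≡ 1 (mod 4)`
and `pf n = 1` if `n' ≡ 3 (mod 4)`.  (The value at `0` is irrelevant.) -/
def pf (n : ℕ) : ℕ := if (n / 2 ^ (n.factorization 2)) % 4 = 1 then 0 else 1

/-- The factor `f_i f_{i+1} ⋯ f_{i+n-1}` of the paperfolding word,
of length `n`, starting at position `i`. -/
def pfFactor (i n : ℕ) : List ℕ := (List.range n).map (fun j => pf (i + j))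

/-- `w` is a factor of the ordinary paperfolding word. -/
def IsPFFactor (w : List ℕ) : Prop := ∃ i : ℕ, 1 ≤ i ∧ w = pfFactor i w.length

/-- The abelian complexity function of the ordinary paperfolding word:
the number of abelian equivalence classes of factors of length `n`,
where the class of a factor `w` is determined by the pair
`(|w|_0, |w|_1)` of numbers of occurrences of `0` and `1` in `w`. -/
noncomputable def ρ (n : ℕ) : ℕ :=
  {p : ℕ × ℕ | ∃ i : ℕ, 1 ≤ i ∧
    p = ((pfFactor i n).count 0, (pfFactor i n).count 1)}.ncard

/-- `Δ w = |w|_0 - |w|_1`. -/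
def Δ (w : List ℕ) : ℤ := (w.count 0 : ℤ) - (w.count 1 : ℤ)

/-- `M n` is the maximum of `Δ w` over all factors `w` of the
paperfolding word of length `n`. -/
noncomputable def M (n : ℕ) : ℤ :=
  sSup {d : ℤ | ∃ i : ℕ, 1 ≤ i ∧ d = Δ (pfFactor i n)}

theorem pf_two_mul {m : ℕ} (hm : m ≠ 0) : pf (2 * m) = pf m := by
  have h : (2 * m).factorization 2 = m.factorization 2 + 1 := by
    rw [Nat.factorization_mul two_ne_zero hm, Finsupp.add_apply,
      Nat.Prime.factorization_self Nat.prime_two, add_comm]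
  unfold pf
  rw [h, pow_succ', Nat.mul_div_mul_left _ _ two_pos]

theorem pf_of_odd {m : ℕ} (hm : m % 2 = 1) : pf m = if m % 4 = 1 then 0 else 1 := by
  have h : m.factorization 2 = 0 := Nat.factorization_eq_zero_of_not_dvd (by omega)
  simp [pf, h]

theorem pf_eq_zero_or_one (m : ℕ) : pf m = 0 ∨ pf m = 1 := by
  unfold pf
  split_ifs <;> simp

theorem pfFactor_succ (i n : ℕ) : pfFactor i (n + 1) = pfFactor i n ++ [pf (i + n)] := by
  simp [pfFactor, List.range_succ]

theorem pfFactor_two (i : ℕ) : pfFactor i 2 = [pf i, pf (i + 1)] := rfl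

/-- The odd positions of a window of length `4 * m` contribute `m` occurrences of each letter, and
its even positions spell a factor of length `2 * m`. -/
theorem count_pfFactor_four_mul {a i : ℕ} (ha : a = 0 ∨ a = 1) (hi : 1 ≤ i) (m : ℕ) :
    (pfFactor i (4 * m)).count a = (pfFactor ((i + 1) / 2) (2 * m)).count a + m := by
  induction m with
  | zero => simp [pfFactor]
  | succ m ih =>
    rw [show 4 * (m + 1) = 4 * m + 1 + 1 + 1 + 1 by ring, show 2 * (m + 1) = 2 * m + 1 + 1 by ring]
    simp only [pfFactor_succ, List.count_append, ih]
    have letters : ∀ k, k % 2 = 1 →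
        List.count a [pf k] + List.count a [pf (k + 2)] = 1 := by
      intro k hk
      rw [pf_of_odd hk, pf_of_odd (show (k + 2) % 2 = 1 by omega)]
      have : k % 4 = 1 ∧ (k + 2) % 4 = 3 ∨ k % 4 = 3 ∧ (k + 2) % 4 = 1 := by omega
      rcases this with ⟨h₁, h₂⟩ | ⟨h₁, h₂⟩ <;> rcases ha with rfl | rfl <;> simp [h₁, h₂]
    obtain ⟨j, rfl | rfl⟩ : ∃ j, i = 2 * j ∨ i = 2 * j + 1 := ⟨i / 2, by omega⟩
    · have h := letters (2 * j + (4 * m + 1)) (by omega)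
      have e₁ : pf (2 * j + 4 * m) = pf (j + 2 * m) := by
        rw [← pf_two_mul (m := j + 2 * m) (by omega)]; congr 1; ring
      have e₂ : pf (2 * j + (4 * m + 1 + 1)) = pf (j + (2 * m + 1)) := by
        rw [← pf_two_mul (m := j + (2 * m + 1)) (by omega)]; congr 1; ring
      rw [e₁, e₂, show (2 * j + 1) / 2 = j by omega]
      simp only [add_assoc, Nat.reduceAdd] at h ⊢
      omega
    · have h := letters (2 * j + 1 + 4 * m) (by omega)
      have e₁ : pf (2 * j + 1 + (4 * m + 1)) = pf (j + 1 + 2 * m) := by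
        rw [← pf_two_mul (m := j + 1 + 2 * m) (by omega)]; congr 1; ring
      have e₂ : pf (2 * j + 1 + (4 * m + 1 + 1 + 1)) = pf (j + 1 + (2 * m + 1)) := by
        rw [← pf_two_mul (m := j + 1 + (2 * m + 1)) (by omega)]; congr 1; ring
      rw [e₁, e₂, show (2 * j + 1 + 1) / 2 = j + 1 by omega]
      simp only [add_assoc] at h ⊢
      omega

theorem ρ_four_mul (m : ℕ) : ρ (4 * m) = ρ (2 * m) := by
  have hinj : Function.Injective (fun p : ℕ × ℕ => p + (m, m)) := add_left_injective _
  unfold ρ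
  rw [← Set.ncard_image_of_injective
    {p : ℕ × ℕ | ∃ i : ℕ, 1 ≤ i ∧
      p = ((pfFactor i (2 * m)).count 0, (pfFactor i (2 * m)).count 1)} hinj]
  congr 1
  ext p
  constructor
  · rintro ⟨i, hi, rfl⟩
    refine ⟨_, ⟨(i + 1) / 2, by omega, rfl⟩, ?_⟩
    simp [count_pfFactor_four_mul, hi]
  · rintro ⟨_, ⟨j, hj, rfl⟩, rfl⟩
    refine ⟨2 * j, by omega, ?_⟩
    have h : 1 ≤ 2 * j := by omega
    simp [count_pfFactor_four_mul, h, show (2 * j + 1) / 2 = j by omega]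

theorem ρ_two : ρ 2 = 3 := by
  have h₁ : pf 1 = 0 := pf_of_odd rfl
  have h₂ : pf 2 = 0 := (pf_two_mul one_ne_zero).trans h₁
  have h₃ : pf 3 = 1 := pf_of_odd rfl
  have h₆ : pf 6 = 1 := (pf_two_mul three_ne_zero).trans h₃
  have h₇ : pf 7 = 1 := pf_of_odd rfl
  have hset : {p : ℕ × ℕ | ∃ i : ℕ, 1 ≤ i ∧
      p = ((pfFactor i 2).count 0, (pfFactor i 2).count 1)} =
      (({(2, 0), (1, 1), (0, 2)} : Finset (ℕ × ℕ)) : Set (ℕ × ℕ)) := by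
    ext p
    simp only [pfFactor_two, Set.mem_ofPred_eq, Finset.coe_insert, Finset.coe_singleton,
      Set.mem_insert_iff, Set.mem_singleton_iff]
    constructor
    · rintro ⟨i, -, rfl⟩
      rcases pf_eq_zero_or_one i with h | h <;>
        rcases pf_eq_zero_or_one (i + 1) with h' | h' <;> simp [h, h']
    · rintro (rfl | rfl | rfl)
      · exact ⟨1, by simp [h₁, h₂]⟩
      · exact ⟨2, by simp [h₂, h₃]⟩
      · exact ⟨6, by simp [h₆, h₇]⟩
  rw [ρ, hset, Set.ncard_coe_finset]
  rfl

/-- `ρ(2^n) = 3` for all `n ≥ 1`. -/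
theorem pf_rho_two_pow : ∀ n : ℕ, 1 ≤ n → ρ (2 ^ n) = 3 := by
  intro n hn
  induction n, hn using Nat.le_induction with
  | base => exact ρ_two
  | succ n hn ih =>
    obtain ⟨k, rfl⟩ := Nat.exists_eq_add_of_le' hn
    rw [show 2 ^ (k + 1 + 1) = 4 * 2 ^ k by ring, ρ_four_mul, ← ih, pow_succ']
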